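/- For every α ∈ (0,∞) with α ≠ 1 and every t ∈ (0, t_α), the map t ↦ h_α(p(·,t)) is twice differentiable and ∂²h_α(p(·,t))/∂t² = (α/12) · [ ((α-2)(α-3) ∫ p^{α-4}p_1⁴ dx − 6 ∫ p^{α-2}p_2² dx) · ∫ p^α dx + 3α(α-1)(∫ p^{α-2}p_1² dx)² ] / (∫ p^α dx)²; equivalently ∂²h_α/∂t² = (α/12) · [ (α-2)(α-3) E_α[p̄₁⁴] − 6 E_α[p̄₂²] + 3α(α-1)(E_α[p̄₁²])² ]. -/

import Mathlib

open MeasureTheory Real Filter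
open scoped Classical

/-- The density `p(x,t)` of `X + √t Z` along the heat flow. -/
noncomputable def heatP (f : ℝ → ℝ) (t x : ℝ) : ℝ :=
  ∫ y : ℝ, f y * ((Real.sqrt (2 * Real.pi * t))⁻¹ * Real.exp (-(x - y) ^ 2 / (2 * t)))

/-- `p_k(x,t) = ∂^k p / ∂x^k`. -/
noncomputable def pk (f : ℝ → ℝ) (k : ℕ) (t x : ℝ) : ℝ :=
  iteratedDeriv k (heatP f t) x

/-- `p̄_i = p_i / p`. -/
noncomputable def pbar (f : ℝ → ℝ) (i : ℕ) (t x : ℝ) : ℝ :=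
  pk f i t x / heatP f t x

/-- The Rényi entropy `h_α(p(·,t))`, with the Shannon entropy at `α = 1`. -/
noncomputable def renyiEnt (f : ℝ → ℝ) (α t : ℝ) : ℝ :=
  if α = 1 then -∫ x : ℝ, heatP f t x * Real.log (heatP f t x)
  else (1 - α)⁻¹ * Real.log (∫ x : ℝ, heatP f t x ^ α)

/-- Finiteness `|h_α(p(·,t))| < ∞` of the Rényi entropy at time `t`. -/
def renyiFinite (f : ℝ → ℝ) (α t : ℝ) : Prop :=
  if α = 1 then Integrable (fun x : ℝ => heatP f t x * Real.log (heatP f t x))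
  else Integrable (fun x : ℝ => heatP f t x ^ α) ∧ 0 < ∫ x : ℝ, heatP f t x ^ α

/-- `t < t_α` where `t_α = sup { s > 0 : |h_α(p(·,s))| < ∞ }`. -/
def ltTalpha (f : ℝ → ℝ) (α t : ℝ) : Prop :=
  ∃ s : ℝ, t < s ∧ 0 < s ∧ renyiFinite f α s

/-- The tilted expectation `E_α[g] = (∫ g p^α) / (∫ p^α)`. -/
noncomputable def Ea (f : ℝ → ℝ) (α t : ℝ) (g : ℝ → ℝ) : ℝ :=
  (∫ x : ℝ, g x * heatP f t x ^ α) / (∫ x : ℝ, heatP f t x ^ α)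

lemma core_aux (α a b t : ℝ) (hat : a < t) (htb : t < b)
    (W q1 q2 q3 B : ℝ → ℝ → ℝ) (G : ℝ → ℝ) (hG : Integrable G)
    (hB1 : ∀ s, a < s → s < b → ∀ x, 1 ≤ B s x)
    (hW : ∀ s, a < s → s < b → ∀ x, 0 < W s x)
    (h1 : ∀ s, a < s → s < b → ∀ x, |q1 s x| ≤ B s x)
    (h2 : ∀ s, a < s → s < b → ∀ x, |q2 s x| ≤ B s x)
    (h3 : ∀ s, a < s → s < b → ∀ x, |q3 s x| ≤ B s x)
    (hWB : ∀ s, a < s → s < b → ∀ x, W s x * B s x ^ 4 ≤ G x)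
    (dxW : ∀ s, a < s → s < b → ∀ x, HasDerivAt (W s) (α * W s x * q1 s x) x)
    (dx1 : ∀ s, a < s → s < b → ∀ x, HasDerivAt (q1 s) (q2 s x - q1 s x ^ 2) x)
    (dx2 : ∀ s, a < s → s < b → ∀ x, HasDerivAt (q2 s) (q3 s x - q1 s x * q2 s x) x)
    (c3 : ∀ s, a < s → s < b → Continuous (q3 s))
    (dtW : ∀ s, a < s → s < b → ∀ x,
      HasDerivAt (fun r => W r x) (α / 2 * (W s x * q2 s x)) s)
    (dt1 : ∀ s, a < s → s < b → ∀ x,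
      HasDerivAt (fun r => q1 r x) ((q3 s x - q1 s x * q2 s x) / 2) s) :
    (Integrable (W t)) ∧
    HasDerivAt (fun s => ∫ x, W s x) (-(α * (α - 1) / 2) * ∫ x, W t x * q1 t x ^ 2) t ∧
    HasDerivAt (fun s => ∫ x, W s x * q1 s x ^ 2)
      ((α - 2) * (α - 3) / 6 * (∫ x, W t x * q1 t x ^ 4) - ∫ x, W t x * q2 t x ^ 2) t := by
  have cW : ∀ s, a < s → s < b → Continuous (W s) := fun s h h' =>
    continuous_iff_continuousAt.2 fun x => (dxW s h h' x).continuousAt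
  have c1 : ∀ s, a < s → s < b → Continuous (q1 s) := fun s h h' =>
    continuous_iff_continuousAt.2 fun x => (dx1 s h h' x).continuousAt
  have c2 : ∀ s, a < s → s < b → Continuous (q2 s) := fun s h h' =>
    continuous_iff_continuousAt.2 fun x => (dx2 s h h' x).continuousAt
  -- basic bound
  have key : ∀ s, a < s → s < b → ∀ x (g : ℝ) (n : ℕ), n ≤ 4 → |g| ≤ B s x ^ n →
      ‖W s x * g‖ ≤ G x := by
    intro s h h' x g n hn hg
    rw [Real.norm_eq_abs, abs_mul, abs_of_pos (hW s h h' x)]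
    refine le_trans ?_ (hWB s h h' x)
    refine mul_le_mul_of_nonneg_left (hg.trans ?_) (hW s h h' x).le
    exact pow_le_pow_right₀ (hB1 s h h' x) hn
  have hB0 : ∀ s, a < s → s < b → ∀ x, 0 ≤ B s x := fun s h h' x =>
    zero_le_one.trans (hB1 s h h' x)
  have bd : ∀ s, a < s → s < b → ∀ x (i j k : ℕ), i + j + k ≤ 4 →
      ‖W s x * (q1 s x ^ i * q2 s x ^ j * q3 s x ^ k)‖ ≤ G x := by
    intro s h h' x i j k hn
    refine key s h h' x _ (i + j + k) hn ?_
    rw [abs_mul, abs_mul, abs_pow, abs_pow, abs_pow, pow_add, pow_add]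
    have := hB0 s h h' x
    have := h1 s h h' x
    have := h2 s h h' x
    have := h3 s h h' x
    gcongr
  have itg : ∀ s, a < s → s < b → ∀ (i j k : ℕ), i + j + k ≤ 4 →
      Integrable (fun x => W s x * (q1 s x ^ i * q2 s x ^ j * q3 s x ^ k)) := by
    intro s h h' i j k hn
    refine hG.mono' ?_ (Eventually.of_forall fun x => bd s h h' x i j k hn)
    have := cW s h h'; have := c1 s h h'; have := c2 s h h'; have := c3 s h h'
    exact Continuous.aestronglyMeasurable (by fun_prop)
  have iW := itg t hat htb 0 0 0 (by norm_num)
  have i1 := itg t hat htb 1 0 0 (by norm_num)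
  have i2 := itg t hat htb 0 1 0 (by norm_num)
  have i11 := itg t hat htb 2 0 0 (by norm_num)
  have i12 := itg t hat htb 1 1 0 (by norm_num)
  have i111 := itg t hat htb 3 0 0 (by norm_num)
  have i1111 := itg t hat htb 4 0 0 (by norm_num)
  have i112 := itg t hat htb 2 1 0 (by norm_num)
  have i22 := itg t hat htb 0 2 0 (by norm_num)
  have i13 := itg t hat htb 1 0 1 (by norm_num)
  simp only [pow_zero, pow_one, one_mul, mul_one] at iW i1 i2 i11 i12 i111 i1111 i112 i22 i13
  -- integrations by parts
  have e1 : (α - 1) * (∫ x, W t x * q1 t x ^ 2) + ∫ x, W t x * q2 t x = 0 := by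
    rw [← integral_const_mul, ← integral_add (i11.const_mul _) i2]
    refine integral_eq_zero_of_hasDerivAt_of_integrable (f := fun x => W t x * q1 t x)
      (fun x => ?_) ((i11.const_mul _).add i2) i1
    refine ((dxW t hat htb x).mul (dx1 t hat htb x)).congr_deriv ?_
    ring
  have e2 : (α - 2) * (∫ x, W t x * (q1 t x ^ 2 * q2 t x)) + (∫ x, W t x * q2 t x ^ 2)
      + ∫ x, W t x * (q1 t x * q3 t x) = 0 := by
    have i3 : Integrable (fun x => (α - 2) * (W t x * (q1 t x ^ 2 * q2 t x))
        + W t x * q2 t x ^ 2) := (i112.const_mul _).add i22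
    rw [← integral_const_mul, ← integral_add (i112.const_mul _) i22, ← integral_add i3 i13]
    refine integral_eq_zero_of_hasDerivAt_of_integrable (f := fun x => W t x * (q1 t x * q2 t x))
      (fun x => ?_) (i3.add i13) i12
    refine ((dxW t hat htb x).mul ((dx1 t hat htb x).mul (dx2 t hat htb x))).congr_deriv ?_
    simp only [Pi.mul_apply]
    ring
  have e3 : (α - 3) * (∫ x, W t x * q1 t x ^ 4) + 3 * ∫ x, W t x * (q1 t x ^ 2 * q2 t x) = 0 := by
    rw [← integral_const_mul, ← integral_const_mul,
      ← integral_add (i1111.const_mul _) (i112.const_mul _)]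
    refine integral_eq_zero_of_hasDerivAt_of_integrable (f := fun x => W t x * q1 t x ^ 3)
      (fun x => ?_) ((i1111.const_mul _).add (i112.const_mul _)) i111
    refine ((dxW t hat htb x).mul ((dx1 t hat htb x).pow 3)).congr_deriv ?_
    simp only [Pi.pow_apply]
    push_cast
    ring
  have hnh : Set.Ioo a b ∈ nhds t := Ioo_mem_nhds hat htb
  refine ⟨iW, ?_, ?_⟩
  · have := (hasDerivAt_integral_of_dominated_loc_of_deriv_le (μ := volume)
      (F := fun s x => W s x) (F' := fun s x => α / 2 * (W s x * q2 s x))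
      (bound := fun x => |α / 2| * G x) (x₀ := t) hnh ?_ iW ?_ ?_ (hG.const_mul _) ?_).2
    · refine this.congr_deriv ?_
      rw [integral_const_mul]
      linear_combination (α / 2) * e1
    · filter_upwards [hnh] with s hs using (cW s hs.1 hs.2).aestronglyMeasurable
    · exact (i2.const_mul _).aestronglyMeasurable
    · refine Eventually.of_forall fun x s hs => ?_
      rw [norm_mul, Real.norm_eq_abs]
      have := bd s hs.1 hs.2 x 0 1 0 (by norm_num)
      simp only [pow_zero, pow_one, one_mul, mul_one] at this
      gcongr
    · exact Eventually.of_forall fun x s hs => dtW s hs.1 hs.2 x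
  · have := (hasDerivAt_integral_of_dominated_loc_of_deriv_le (μ := volume)
      (F := fun s x => W s x * q1 s x ^ 2)
      (F' := fun s x => (α / 2 - 1) * (W s x * (q1 s x ^ 2 * q2 s x)) + W s x * (q1 s x * q3 s x))
      (bound := fun x => |α / 2 - 1| * G x + G x) (x₀ := t) hnh ?_ i11 ?_ ?_
        ((hG.const_mul _).add hG) ?_).2
    · refine this.congr_deriv ?_
      rw [integral_add (i112.const_mul _) i13, integral_const_mul]
      linear_combination e2 - (α - 2) / 6 * e3
    · filter_upwards [hnh] with s hs
      have := cW s hs.1 hs.2; have := c1 s hs.1 hs.2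
      exact Continuous.aestronglyMeasurable (by fun_prop)
    · exact ((i112.const_mul _).add i13).aestronglyMeasurable
    · refine Eventually.of_forall fun x s hs => ?_
      refine (norm_add_le _ _).trans ?_
      rw [norm_mul, Real.norm_eq_abs (α / 2 - 1)]
      have := bd s hs.1 hs.2 x 2 1 0 (by norm_num)
      have := bd s hs.1 hs.2 x 1 0 1 (by norm_num)
      simp only [pow_zero, pow_one, one_mul, mul_one] at *
      gcongr
    · refine Eventually.of_forall fun x s hs => ?_
      refine ((dtW s hs.1 hs.2 x).mul ((dt1 s hs.1 hs.2 x).pow 2)).congr_deriv ?_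
      simp only [Pi.pow_apply]
      push_cast
      ring

noncomputable def MM (f : ℝ → ℝ) (k : ℕ) (t x : ℝ) : ℝ :=
  ∫ y : ℝ, f y * ((x - y) ^ k * Real.exp (-(x - y) ^ 2 / (2 * t)))

lemma gauss_bd (k : ℕ) (κ : ℝ) (hκ : 0 < κ) :
    ∃ C : ℝ, 0 ≤ C ∧ ∀ w : ℝ, |w| ^ k * Real.exp (-(κ * w ^ 2)) ≤ C := by
  refine ⟨1 + k.factorial / κ ^ k, by positivity, fun w => ?_⟩
  have h1 : |w| ^ k ≤ 1 + (w ^ 2) ^ k := by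
    have : (w ^ 2) ^ k = (|w| ^ k) ^ 2 := by rw [← sq_abs]; ring
    rw [this]
    nlinarith [sq_nonneg (|w| ^ k - 1), pow_nonneg (abs_nonneg w) k]
  have h2 := Real.pow_div_factorial_le_exp (κ * w ^ 2) (by positivity) k
  have hf : (0 : ℝ) < k.factorial := by positivity
  rw [div_le_iff₀ hf, mul_pow] at h2
  rw [Real.exp_neg, ← div_eq_mul_inv, div_le_iff₀ (Real.exp_pos _)]
  have h3 : (w ^ 2) ^ k ≤ k.factorial / κ ^ k * Real.exp (κ * w ^ 2) := by
    rw [div_mul_eq_mul_div, le_div_iff₀ (by positivity)]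
    linarith
  have h4 : 1 ≤ Real.exp (κ * w ^ 2) := Real.one_le_exp (by positivity)
  linarith

lemma kern_bd (k : ℕ) (b : ℝ) (hb : 0 < b) :
    ∃ C : ℝ, 0 ≤ C ∧ ∀ t, 0 < t → t ≤ b → ∀ w : ℝ,
      ‖w ^ k * Real.exp (-w ^ 2 / (2 * t))‖ ≤ C := by
  obtain ⟨C, hC, h⟩ := gauss_bd k (1 / (2 * b)) (by positivity)
  refine ⟨C, hC, fun t ht htb w => le_trans ?_ (h w)⟩
  rw [norm_mul, norm_pow, Real.norm_eq_abs, Real.norm_eq_abs, Real.abs_exp, neg_div]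
  have : 1 / (2 * b) * w ^ 2 ≤ w ^ 2 / (2 * t) := by
    rw [one_div_mul_eq_div]; gcongr
  gcongr

lemma kern_int (f : ℝ → ℝ) (hf : Integrable f) (k : ℕ) (t : ℝ) (ht : 0 < t) (x : ℝ) :
    Integrable (fun y => f y * ((x - y) ^ k * Real.exp (-(x - y) ^ 2 / (2 * t)))) := by
  obtain ⟨C, hC, h⟩ := kern_bd k t ht
  refine hf.mul_bdd (c := C) ?_ (Eventually.of_forall fun y => h t ht le_rfl (x - y))
  exact Continuous.aestronglyMeasurable (by fun_prop)

lemma MM_dx (f : ℝ → ℝ) (hf : Integrable f) (k : ℕ) (t : ℝ) (ht : 0 < t) (x : ℝ) :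
    HasDerivAt (MM f k t) (k * MM f (k - 1) t x - MM f (k + 1) t x / t) x := by
  obtain ⟨C1, hC1, h1⟩ := kern_bd (k - 1) t ht
  obtain ⟨C2, hC2, h2⟩ := kern_bd (k + 1) t ht
  have I1 := (kern_int f hf (k - 1) t ht x).const_mul (k : ℝ)
  have I2 := (kern_int f hf (k + 1) t ht x).div_const t
  have := (hasDerivAt_integral_of_dominated_loc_of_deriv_le (μ := volume)
    (F := fun x y => f y * ((x - y) ^ k * Real.exp (-(x - y) ^ 2 / (2 * t))))
    (F' := fun x y => k * (f y * ((x - y) ^ (k - 1) * Real.exp (-(x - y) ^ 2 / (2 * t))))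
      - f y * ((x - y) ^ (k + 1) * Real.exp (-(x - y) ^ 2 / (2 * t))) / t)
    (bound := fun y => k * (‖f y‖ * C1) + ‖f y‖ * C2 / t) (x₀ := x) univ_mem
    ?_ (kern_int f hf k t ht x) ?_ ?_ ?_ ?_).2
  · refine this.congr_deriv ?_
    rw [integral_sub I1 I2, integral_const_mul, integral_div]; rfl
  · exact Eventually.of_forall fun x => (kern_int f hf k t ht x).aestronglyMeasurable
  · exact (I1.sub I2).aestronglyMeasurable
  · refine Eventually.of_forall fun y x _ => (norm_sub_le _ _).trans ?_
    have a1 := h1 t ht le_rfl (x - y)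
    have a2 := h2 t ht le_rfl (x - y)
    rw [norm_mul, norm_mul (f y), norm_div, norm_mul (f y), Real.norm_natCast,
      Real.norm_of_nonneg ht.le]
    gcongr
  · exact ((hf.norm.mul_const _).const_mul _).add ((hf.norm.mul_const _).div_const _)
  · refine Eventually.of_forall fun y x _ => ?_
    have d1 : HasDerivAt (fun x : ℝ => x - y) 1 x := (hasDerivAt_id x).sub_const y
    have d2 := (d1.pow k).mul (((d1.pow 2).neg.div_const (2 * t)).exp)
    refine (d2.const_mul (f y)).congr_deriv ?_
    simp only [Pi.pow_apply, Pi.neg_apply]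
    field_simp
    ring

lemma MM_dt (f : ℝ → ℝ) (hf : Integrable f) (k : ℕ) (t : ℝ) (ht : 0 < t) (x : ℝ) :
    HasDerivAt (fun s => MM f k s x) (MM f (k + 2) t x / (2 * t ^ 2)) t := by
  obtain ⟨C2, hC2, h2⟩ := kern_bd (k + 2) (2 * t) (by positivity)
  have I2 := (kern_int f hf (k + 2) t ht x).div_const (2 * t ^ 2)
  have := (hasDerivAt_integral_of_dominated_loc_of_deriv_le (μ := volume)
    (F := fun s y => f y * ((x - y) ^ k * Real.exp (-(x - y) ^ 2 / (2 * s))))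
    (F' := fun s y =>
      f y * ((x - y) ^ (k + 2) * Real.exp (-(x - y) ^ 2 / (2 * s))) / (2 * s ^ 2))
    (bound := fun y => ‖f y‖ * C2 / (2 * (t / 2) ^ 2)) (x₀ := t) (s := Set.Ioo (t / 2) (2 * t))
    (Ioo_mem_nhds (by linarith) (by linarith))
    ?_ (kern_int f hf k t ht x) ?_ ?_ ?_ ?_).2
  · refine this.congr_deriv ?_
    rw [integral_div]; rfl
  · filter_upwards [lt_mem_nhds ht] with s hs
    exact (kern_int f hf k s hs x).aestronglyMeasurable
  · exact I2.aestronglyMeasurable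
  · refine Eventually.of_forall fun y s hs => ?_
    have hs0 : 0 < s := by linarith [hs.1]
    have hs1 := hs.1.le
    have a2 := h2 s hs0 hs.2.le (x - y)
    rw [norm_div, norm_mul (f y), Real.norm_of_nonneg (show 0 ≤ 2 * s ^ 2 by positivity)]
    gcongr
  · exact ((hf.norm.mul_const _).div_const _)
  · refine Eventually.of_forall fun y s hs => ?_
    have hs0 : 0 < s := by linarith [hs.1]
    have d1 : HasDerivAt (fun s : ℝ => -(x - y) ^ 2 / (2 * s))
        ((x - y) ^ 2 / (2 * s ^ 2)) s := by
      refine ((hasDerivAt_const s (-(x - y) ^ 2)).div ((hasDerivAt_id s).const_mul 2)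
        (by simpa using hs0.ne')).congr_deriv ?_
      simp only [id]
      field_simp
      ring
    refine ((d1.exp.const_mul ((x - y) ^ k)).const_mul (f y)).congr_deriv ?_
    field_simp
    ring

lemma MM0_pos (f : ℝ → ℝ) (hf0 : ∀ x, 0 ≤ f x) (hf1 : (∫ x : ℝ, f x) = 1) (hf : Integrable f)
    (t : ℝ) (ht : 0 < t) (x : ℝ) : 0 < MM f 0 t x := by
  have h := (integral_pos_iff_support_of_nonneg hf0 hf).1 (by rw [hf1]; norm_num)
  refine (integral_pos_iff_support_of_nonneg (fun y => ?_) (kern_int f hf 0 t ht x)).2 ?_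
  · have := hf0 y
    simp only [Pi.zero_apply]; positivity
  · convert h using 2
    ext y
    simp [Real.exp_ne_zero]

lemma MM0_mono (f : ℝ → ℝ) (hf0 : ∀ x, 0 ≤ f x) (hf : Integrable f)
    (t s : ℝ) (ht : 0 < t) (hts : t ≤ s) (x : ℝ) : MM f 0 t x ≤ MM f 0 s x := by
  refine integral_mono (kern_int f hf 0 t ht x) (kern_int f hf 0 s (by linarith) x) fun y => ?_
  have := hf0 y
  simp only [neg_div]
  gcongr

lemma memLp_rpow_aux (u : ℝ → ℝ) (hu0 : ∀ y, 0 ≤ u y) (hu : Integrable u) (θ : ℝ) (hθ : 0 < θ) :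
    MemLp (fun y => u y ^ θ) (ENNReal.ofReal θ⁻¹) := by
  have h := (memLp_one_iff_integrable.2 hu).norm_rpow_div (ENNReal.ofReal θ)
  rw [ENNReal.toReal_ofReal hθ.le, one_div, ← ENNReal.ofReal_inv_of_pos hθ] at h
  simpa [abs_of_nonneg (hu0 _)] using h

lemma MM_holder (f : ℝ → ℝ) (hf0 : ∀ x, 0 ≤ f x) (hf : Integrable f) (k : ℕ)
    (θ b s : ℝ) (hθ : 0 < θ) (hθ1 : θ < 1) (hb : 0 < b) (hbs : b < s) :
    ∃ C : ℝ, 0 ≤ C ∧ ∀ t, 0 < t → t ≤ b → ∀ x,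
      |MM f k t x| ≤ C * (MM f 0 t x ^ (1 - θ) * MM f 0 s x ^ θ) := by
  have hs : 0 < s := hb.trans hbs
  have hκ : 0 < θ * (1 / (2 * b) - 1 / (2 * s)) := by
    refine mul_pos hθ (sub_pos.2 ?_)
    gcongr
  obtain ⟨C, hC, h⟩ := gauss_bd k _ hκ
  refine ⟨C, hC, fun t ht htb x => ?_⟩
  have hE : ∀ t : ℝ, ∀ y, f y * ((x - y) ^ 0 * Real.exp (-(x - y) ^ 2 / (2 * t)))
      = f y * Real.exp (-(x - y) ^ 2 / (2 * t)) := fun t y => by rw [pow_zero, one_mul]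
  have It := kern_int f hf 0 t ht x
  have Is := kern_int f hf 0 s hs x
  have Ik := kern_int f hf k t ht x
  simp only [hE] at It Is
  unfold MM
  simp only [hE]
  set u : ℝ → ℝ := fun y => f y * Real.exp (-(x - y) ^ 2 / (2 * t)) with hu
  set v : ℝ → ℝ := fun y => f y * Real.exp (-(x - y) ^ 2 / (2 * s)) with hv
  have u0 : ∀ y, 0 ≤ u y := fun y => mul_nonneg (hf0 y) (Real.exp_pos _).le
  have v0 : ∀ y, 0 ≤ v y := fun y => mul_nonneg (hf0 y) (Real.exp_pos _).le
  have m1 := memLp_rpow_aux u u0 It (1 - θ) (by linarith)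
  have m2 := memLp_rpow_aux v v0 Is θ hθ
  have hc : Real.HolderConjugate (1 - θ)⁻¹ θ⁻¹ := by
    rw [Real.holderConjugate_iff]
    exact ⟨(one_lt_inv₀ (by linarith)).2 (by linarith), by simp⟩
  have hold := integral_mul_le_Lp_mul_Lq_of_nonneg hc (μ := volume)
    (Eventually.of_forall fun y => Real.rpow_nonneg (u0 y) _)
    (Eventually.of_forall fun y => Real.rpow_nonneg (v0 y) _) m1 m2
  have e1 : ∀ y, (u y ^ (1 - θ)) ^ (1 - θ)⁻¹ = u y := fun y =>
    Real.rpow_rpow_inv (u0 y) (by linarith)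
  have e2 : ∀ y, (v y ^ θ) ^ θ⁻¹ = v y := fun y => Real.rpow_rpow_inv (v0 y) hθ.ne'
  simp only [e1, e2, one_div, inv_inv] at hold
  have Iuv : Integrable (fun y => u y ^ (1 - θ) * v y ^ θ) := by
    have : ENNReal.HolderConjugate (ENNReal.ofReal (1 - θ)⁻¹) (ENNReal.ofReal θ⁻¹) :=
      hc.ennrealOfReal
    exact m1.integrable_mul m2
  refine le_trans ?_ (mul_le_mul_of_nonneg_left hold hC)
  rw [← integral_const_mul]
  refine (abs_integral_le_integral_abs).trans (integral_mono Ik.abs (Iuv.const_mul C) fun y => ?_)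
  have hw := h (x - y)
  set w := x - y
  have k1 : u y ^ (1 - θ) * v y ^ θ = f y * (Real.exp (-w ^ 2 / (2 * t)) ^ (1 - θ) *
      Real.exp (-w ^ 2 / (2 * s)) ^ θ) := by
    simp only [hu, hv]
    rw [Real.mul_rpow (hf0 y) (Real.exp_pos _).le, Real.mul_rpow (hf0 y) (Real.exp_pos _).le]
    have : f y ^ (1 - θ) * f y ^ θ = f y := by
      rw [← Real.rpow_add_of_nonneg (hf0 y) (by linarith) hθ.le]; simp
    calc _ = (f y ^ (1 - θ) * f y ^ θ) * (Real.exp (-w ^ 2 / (2 * t)) ^ (1 - θ) *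
      Real.exp (-w ^ 2 / (2 * s)) ^ θ) := by ring
      _ = _ := by rw [this]
  simp only
  rw [k1, ← Real.exp_mul, ← Real.exp_mul, ← Real.exp_add, abs_mul, abs_of_nonneg (hf0 y), abs_mul,
    abs_pow, Real.abs_exp]
  have k2 : Real.exp (-w ^ 2 / (2 * t)) ≤ Real.exp (-(θ * (1 / (2 * b) - 1 / (2 * s)) * w ^ 2)) *
      Real.exp (-w ^ 2 / (2 * t) * (1 - θ) + -w ^ 2 / (2 * s) * θ) := by
    rw [← Real.exp_add]
    refine Real.exp_le_exp.2 ?_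
    have : θ * w ^ 2 * (1 / (2 * b)) ≤ θ * w ^ 2 * (1 / (2 * t)) := by gcongr
    have e : -w ^ 2 / (2 * t) = - (w ^ 2 * (1 / (2 * t))) := by ring
    have e' : -w ^ 2 / (2 * s) = - (w ^ 2 * (1 / (2 * s))) := by ring
    rw [e, e']
    linarith
  calc f y * (|w| ^ k * Real.exp (-w ^ 2 / (2 * t)))
      ≤ f y * (|w| ^ k * (Real.exp (-(θ * (1 / (2 * b) - 1 / (2 * s)) * w ^ 2)) *
      Real.exp (-w ^ 2 / (2 * t) * (1 - θ) + -w ^ 2 / (2 * s) * θ))) := by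
        have := hf0 y
        gcongr
    _ = (|w| ^ k * Real.exp (-(θ * (1 / (2 * b) - 1 / (2 * s)) * w ^ 2))) * (f y *
      Real.exp (-w ^ 2 / (2 * t) * (1 - θ) + -w ^ 2 / (2 * s) * θ)) := by ring
    _ ≤ _ := by
        have := hf0 y
        gcongr

noncomputable def cc (t : ℝ) : ℝ := (Real.sqrt (2 * Real.pi * t))⁻¹

lemma cc_pos (t : ℝ) (ht : 0 < t) : 0 < cc t := by
  unfold cc; positivity

lemma cc_anti (a t : ℝ) (ha : 0 < a) (h : a ≤ t) : cc t ≤ cc a := by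
  unfold cc; gcongr

lemma cc_dt (t : ℝ) (ht : 0 < t) : HasDerivAt cc (-cc t / (2 * t)) t := by
  have h0 : 0 < 2 * Real.pi * t := by positivity
  have h1 : HasDerivAt (fun s : ℝ => 2 * Real.pi * s) (2 * Real.pi) t := by
    simpa using (hasDerivAt_id t).const_mul (2 * Real.pi)
  refine ((h1.sqrt h0.ne').inv (Real.sqrt_pos.2 h0).ne').congr_deriv ?_
  unfold cc
  have hs : Real.sqrt (2 * Real.pi * t) ^ 2 = 2 * Real.pi * t := Real.sq_sqrt h0.le
  have hs0 := Real.sqrt_pos.2 h0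
  rw [hs]
  field_simp

lemma heatP_eq (f : ℝ → ℝ) (t x : ℝ) : heatP f t x = cc t * MM f 0 t x := by
  unfold heatP MM cc
  rw [← integral_const_mul]
  congr 1
  ext y
  rw [pow_zero]
  ring

noncomputable def Q1 (f : ℝ → ℝ) (t x : ℝ) : ℝ := -(MM f 1 t x / MM f 0 t x) / t
noncomputable def Q2 (f : ℝ → ℝ) (t x : ℝ) : ℝ := (MM f 2 t x / MM f 0 t x) / t ^ 2 - 1 / t
noncomputable def Q3 (f : ℝ → ℝ) (t x : ℝ) : ℝ :=
  -(MM f 3 t x / MM f 0 t x) / t ^ 3 + 3 * (MM f 1 t x / MM f 0 t x) / t ^ 2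


lemma heatP_pos (f : ℝ → ℝ) (hf0 : ∀ x, 0 ≤ f x) (hf1 : (∫ x : ℝ, f x) = 1)
    (hf : Integrable f) (t : ℝ) (ht : 0 < t) (x : ℝ) : 0 < heatP f t x := by
  rw [heatP_eq]; exact mul_pos (cc_pos t ht) (MM0_pos f hf0 hf1 hf t ht x)

lemma heatP_dx (f : ℝ → ℝ) (hf0 : ∀ x, 0 ≤ f x) (hf1 : (∫ x : ℝ, f x) = 1)
    (hf : Integrable f) (t : ℝ) (ht : 0 < t) (x : ℝ) :
    HasDerivAt (heatP f t) (heatP f t x * Q1 f t x) x := by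
  have e : heatP f t = fun x => cc t * MM f 0 t x := funext fun x => heatP_eq f t x
  have hM := MM0_pos f hf0 hf1 hf t ht x
  rw [e]
  refine ((MM_dx f hf 0 t ht x).const_mul (cc t)).congr_deriv ?_
  unfold Q1
  push_cast
  field_simp
  ring

lemma Q1_dx (f : ℝ → ℝ) (hf0 : ∀ x, 0 ≤ f x) (hf1 : (∫ x : ℝ, f x) = 1)
    (hf : Integrable f) (t : ℝ) (ht : 0 < t) (x : ℝ) :
    HasDerivAt (Q1 f t) (Q2 f t x - Q1 f t x ^ 2) x := by
  have hM := MM0_pos f hf0 hf1 hf t ht x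
  refine ((((MM_dx f hf 1 t ht x).div (MM_dx f hf 0 t ht x) hM.ne').neg).div_const t).congr_deriv ?_
  unfold Q1 Q2
  push_cast
  field_simp
  ring

lemma Q2_dx (f : ℝ → ℝ) (hf0 : ∀ x, 0 ≤ f x) (hf1 : (∫ x : ℝ, f x) = 1)
    (hf : Integrable f) (t : ℝ) (ht : 0 < t) (x : ℝ) :
    HasDerivAt (Q2 f t) (Q3 f t x - Q1 f t x * Q2 f t x) x := by
  have hM := MM0_pos f hf0 hf1 hf t ht x
  refine ((((MM_dx f hf 2 t ht x).div (MM_dx f hf 0 t ht x) hM.ne').div_const (t ^ 2)).sub_const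
    (1 / t)).congr_deriv ?_
  unfold Q1 Q2 Q3
  push_cast
  field_simp
  ring

lemma Q3_cont (f : ℝ → ℝ) (hf0 : ∀ x, 0 ≤ f x) (hf1 : (∫ x : ℝ, f x) = 1)
    (hf : Integrable f) (t : ℝ) (ht : 0 < t) : Continuous (Q3 f t) := by
  have c : ∀ k, Continuous (MM f k t) := fun k =>
    continuous_iff_continuousAt.2 fun x => (MM_dx f hf k t ht x).continuousAt
  have h0 : ∀ x, MM f 0 t x ≠ 0 := fun x => (MM0_pos f hf0 hf1 hf t ht x).ne'
  have d : ∀ k, Continuous (fun x => MM f k t x / MM f 0 t x) := fun k => (c k).div (c 0) h0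
  have d1 := d 1
  have d3 := d 3
  unfold Q3
  fun_prop

lemma heatP_dt (f : ℝ → ℝ) (hf0 : ∀ x, 0 ≤ f x) (hf1 : (∫ x : ℝ, f x) = 1)
    (hf : Integrable f) (t : ℝ) (ht : 0 < t) (x : ℝ) :
    HasDerivAt (fun s => heatP f s x) (heatP f t x * Q2 f t x / 2) t := by
  have e : (fun s => heatP f s x) = fun s => cc s * MM f 0 s x := funext fun s => heatP_eq f s x
  have hM := MM0_pos f hf0 hf1 hf t ht x
  rw [e, heatP_eq]
  refine ((cc_dt t ht).mul (MM_dt f hf 0 t ht x)).congr_deriv ?_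
  unfold Q2
  simp only [zero_add]
  field_simp
  ring

lemma Q1_dt (f : ℝ → ℝ) (hf0 : ∀ x, 0 ≤ f x) (hf1 : (∫ x : ℝ, f x) = 1)
    (hf : Integrable f) (t : ℝ) (ht : 0 < t) (x : ℝ) :
    HasDerivAt (fun s => Q1 f s x) ((Q3 f t x - Q1 f t x * Q2 f t x) / 2) t := by
  have hM := MM0_pos f hf0 hf1 hf t ht x
  refine ((((MM_dt f hf 1 t ht x).div (MM_dt f hf 0 t ht x) hM.ne').neg).div
    (hasDerivAt_id t) ht.ne').congr_deriv ?_
  unfold Q1 Q2 Q3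
  simp only [zero_add, Nat.reduceAdd, id, Pi.neg_apply, Pi.div_apply]
  field_simp
  ring

lemma pbar1_eq (f : ℝ → ℝ) (hf0 : ∀ x, 0 ≤ f x) (hf1 : (∫ x : ℝ, f x) = 1)
    (hf : Integrable f) (t : ℝ) (ht : 0 < t) (x : ℝ) : pbar f 1 t x = Q1 f t x := by
  unfold pbar pk
  rw [iteratedDeriv_one, (heatP_dx f hf0 hf1 hf t ht x).deriv]
  have := heatP_pos f hf0 hf1 hf t ht x
  field_simp

lemma pbar2_eq (f : ℝ → ℝ) (hf0 : ∀ x, 0 ≤ f x) (hf1 : (∫ x : ℝ, f x) = 1)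
    (hf : Integrable f) (t : ℝ) (ht : 0 < t) (x : ℝ) : pbar f 2 t x = Q2 f t x := by
  unfold pbar pk
  have e : deriv (heatP f t) = fun x => heatP f t x * Q1 f t x :=
    funext fun x => (heatP_dx f hf0 hf1 hf t ht x).deriv
  rw [iteratedDeriv_succ, iteratedDeriv_one, e]
  have h : deriv (fun x => heatP f t x * Q1 f t x) x = _ :=
    ((heatP_dx f hf0 hf1 hf t ht x).mul (Q1_dx f hf0 hf1 hf t ht x)).deriv
  rw [h]
  have := heatP_pos f hf0 hf1 hf t ht x
  field_simp
  ring

lemma rpow_pk (p P α : ℝ) (n : ℕ) (hp : 0 < p) :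
    p ^ (α - n) * P ^ n = p ^ α * (P / p) ^ n := by
  rw [Real.rpow_sub_natCast hp.ne', div_pow]
  ring

lemma Q_bounds (m1 m2 m3 t a A D R : ℝ) (ha : 0 < a) (hat : a < t) (hA : A = 1 + 1 / a)
    (hD : 1 ≤ D) (hR : 1 ≤ R) (h1 : |m1| ≤ D * R) (h2 : |m2| ≤ D * R) (h3 : |m3| ≤ D * R) :
    |-m1 / t| ≤ 4 * D * A ^ 3 * R ∧ |m2 / t ^ 2 - 1 / t| ≤ 4 * D * A ^ 3 * R ∧
    |-m3 / t ^ 3 + 3 * m1 / t ^ 2| ≤ 4 * D * A ^ 3 * R := by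
  have ht : 0 < t := ha.trans hat
  have hA1 : 1 ≤ A := by rw [hA]; have : 0 < 1 / a := by positivity
                         linarith
  have hi : 1 / t ≤ A := by
    have : 1 / t ≤ 1 / a := by gcongr
    linarith
  have hi0 : 0 < 1 / t := by positivity
  have e1 : -m1 / t = -(m1 * (1 / t)) := by ring
  have e2 : m2 / t ^ 2 - 1 / t = m2 * (1 / t) ^ 2 - 1 / t := by ring
  have e3 : -m3 / t ^ 3 + 3 * m1 / t ^ 2 = -(m3 * (1 / t) ^ 3) + 3 * (m1 * (1 / t) ^ 2) := by ring
  rw [e1, e2, e3]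
  generalize 1 / t = i at *
  have hDR : 1 ≤ D * R := one_le_mul_of_one_le_of_one_le hD hR
  have a1 : A ≤ A ^ 3 := le_self_pow₀ hA1 (by norm_num)
  have a2 : A ^ 2 ≤ A ^ 3 := pow_le_pow_right₀ hA1 (by norm_num)
  have b : ∀ m, |m| ≤ D * R → ∀ n, n ≤ 3 → |m * i ^ n| ≤ D * R * A ^ 3 := by
    intro m hm n hn
    rw [abs_mul, abs_of_pos (pow_pos hi0 n)]
    have : i ^ n ≤ A ^ n := by gcongr
    have : i ^ n ≤ A ^ 3 := this.trans (pow_le_pow_right₀ hA1 hn)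
    gcongr
  have hpos : 0 ≤ D * R * A ^ 3 := by positivity
  have hi3 : i ≤ D * R * A ^ 3 := by nlinarith
  have c1 := b m1 h1 1 (by norm_num)
  have c2 := b m2 h2 2 (by norm_num)
  have c3 := b m3 h3 3 (by norm_num)
  have c4 := b m1 h1 2 (by norm_num)
  rw [pow_one] at c1
  rw [abs_le] at c1 c2 c3 c4
  refine ⟨?_, ?_, ?_⟩ <;> rw [abs_le] <;> constructor <;> linarith

lemma renyi_core (f : ℝ → ℝ) (hf0 : ∀ x, 0 ≤ f x) (hf1 : (∫ x : ℝ, f x) = 1)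
    (hf : Integrable f) (α : ℝ) (hα : 0 < α) (s : ℝ)
    (hI : Integrable (fun x => heatP f s x ^ α)) (t : ℝ) (ht : 0 < t) (hts : t < s) :
    (Integrable (fun x => heatP f t x ^ α)) ∧
    HasDerivAt (fun r => ∫ x, heatP f r x ^ α)
      (-(α * (α - 1) / 2) * ∫ x, heatP f t x ^ α * Q1 f t x ^ 2) t ∧
    HasDerivAt (fun r => ∫ x, heatP f r x ^ α * Q1 f r x ^ 2)
      ((α - 2) * (α - 3) / 6 * (∫ x, heatP f t x ^ α * Q1 f t x ^ 4)
        - ∫ x, heatP f t x ^ α * Q2 f t x ^ 2) t := by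
  obtain ⟨b, htb, hbs⟩ := exists_between hts
  obtain ⟨a, ha, hat⟩ := exists_between ht
  have hb : 0 < b := ht.trans htb
  have hs : 0 < s := ht.trans hts
  obtain ⟨θ, hθ, hθ1, hθα⟩ : ∃ θ : ℝ, 0 < θ ∧ θ < 1 ∧ 4 * θ ≤ α := by
    refine ⟨min (1 / 2) (α / 4), by positivity, ?_, ?_⟩
    · exact (min_le_left _ _).trans_lt (by norm_num)
    · have := min_le_right (1 / 2) (α / 4)
      linarith
  obtain ⟨C1, hC1, h1⟩ := MM_holder f hf0 hf 1 θ b s hθ hθ1 hb hbs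
  obtain ⟨C2, hC2, h2⟩ := MM_holder f hf0 hf 2 θ b s hθ hθ1 hb hbs
  obtain ⟨C3, hC3, h3⟩ := MM_holder f hf0 hf 3 θ b s hθ hθ1 hb hbs
  obtain ⟨D, hD⟩ : ∃ D, D = 1 + C1 + C2 + C3 := ⟨_, rfl⟩
  obtain ⟨A, hA⟩ : ∃ A, A = 1 + 1 / a := ⟨_, rfl⟩
  have hD1 : 1 ≤ D := by rw [hD]; linarith
  have hA0 : 1 ≤ A := by
    rw [hA]
    have : 0 < 1 / a := by positivity
    linarith
  have hM := fun r hr x => MM0_pos f hf0 hf1 hf r hr x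
  have hR1 : ∀ r, a < r → r < b → ∀ x, 1 ≤ MM f 0 s x / MM f 0 r x := by
    intro r har hrb x
    rw [one_le_div (hM r (ha.trans har) x)]
    exact MM0_mono f hf0 hf r s (ha.trans har) (hrb.trans hbs).le x
  have hRθ : ∀ r, a < r → r < b → ∀ x, 1 ≤ (MM f 0 s x / MM f 0 r x) ^ θ := fun r har hrb x =>
    Real.one_le_rpow (hR1 r har hrb x) hθ.le
  have hm : ∀ k C, 0 ≤ C → C ≤ D → (∀ t, 0 < t → t ≤ b → ∀ x,
      |MM f k t x| ≤ C * (MM f 0 t x ^ (1 - θ) * MM f 0 s x ^ θ)) →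
      ∀ r, a < r → r < b → ∀ x, |MM f k r x / MM f 0 r x| ≤ D * (MM f 0 s x / MM f 0 r x) ^ θ := by
    intro k C hC hCD h r har hrb x
    have hr := ha.trans har
    have h0 := hM r hr x
    have hs0 := hM s hs x
    rw [abs_div, abs_of_pos h0, div_le_iff₀ h0]
    refine (h r hr hrb.le x).trans ?_
    rw [Real.div_rpow hs0.le h0.le, Real.rpow_sub h0, Real.rpow_one]
    calc C * (MM f 0 r x / MM f 0 r x ^ θ * MM f 0 s x ^ θ)
        ≤ D * (MM f 0 r x / MM f 0 r x ^ θ * MM f 0 s x ^ θ) := by gcongr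
      _ = _ := by ring
  have hq : ∀ r, a < r → r < b → ∀ x, _ := fun r har hrb x =>
    Q_bounds (MM f 1 r x / MM f 0 r x) (MM f 2 r x / MM f 0 r x) (MM f 3 r x / MM f 0 r x)
      r a A D ((MM f 0 s x / MM f 0 r x) ^ θ) ha har hA hD1 (hRθ r har hrb x)
      (hm 1 C1 hC1 (by linarith) h1 r har hrb x) (hm 2 C2 hC2 (by linarith) h2 r har hrb x)
      (hm 3 C3 hC3 (by linarith) h3 r har hrb x)
  have hP := fun r hr x => heatP_pos f hf0 hf1 hf r hr x
  refine core_aux α a b t hat htb (fun r x => heatP f r x ^ α) (Q1 f) (Q2 f) (Q3 f)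
    (fun r x => 4 * D * A ^ 3 * (MM f 0 s x / MM f 0 r x) ^ θ)
    (fun x => ((4 * D * A ^ 3) ^ 4 * (cc a / cc s) ^ α) * heatP f s x ^ α)
    (hI.const_mul _) ?_ ?_ ?_ ?_ ?_ ?_ ?_ ?_ ?_ ?_ ?_ ?_
  · intro r har hrb x
    have : 1 ≤ A ^ 3 := one_le_pow₀ hA0
    have h4 : 1 ≤ 4 * D * A ^ 3 := by nlinarith
    exact one_le_mul_of_one_le_of_one_le h4 (hRθ r har hrb x)
  · exact fun r har hrb x => Real.rpow_pos_of_pos (hP r (ha.trans har) x) _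
  · exact fun r har hrb x => (hq r har hrb x).1
  · exact fun r har hrb x => (hq r har hrb x).2.1
  · exact fun r har hrb x => (hq r har hrb x).2.2
  · intro r har hrb x
    have hr := ha.trans har
    have h0 := hM r hr x
    have hs0 := hM s hs x
    have r1 := hR1 r har hrb x
    have p4 : ((MM f 0 s x / MM f 0 r x) ^ θ) ^ 4 ≤ (MM f 0 s x / MM f 0 r x) ^ α := by
      rw [← Real.rpow_mul_natCast (by positivity)]
      refine Real.rpow_le_rpow_of_exponent_le r1 ?_
      push_cast
      linarith
    have hcs := cc_pos s hs
    have hcr := cc_pos r hr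
    have hca := cc_pos a ha
    have hc := cc_anti a r ha har.le
    rw [mul_pow]
    calc heatP f r x ^ α * ((4 * D * A ^ 3) ^ 4 * ((MM f 0 s x / MM f 0 r x) ^ θ) ^ 4)
        ≤ heatP f r x ^ α * ((4 * D * A ^ 3) ^ 4 * (MM f 0 s x / MM f 0 r x) ^ α) := by
          have := (Real.rpow_pos_of_pos (hP r hr x) α).le
          gcongr
      _ = (4 * D * A ^ 3) ^ 4 * (heatP f r x * (MM f 0 s x / MM f 0 r x)) ^ α := by
          rw [Real.mul_rpow (hP r hr x).le (by positivity)]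
          ring
      _ = (4 * D * A ^ 3) ^ 4 * (cc r * MM f 0 s x) ^ α := by
          rw [heatP_eq]
          congr 2
          field_simp
      _ ≤ (4 * D * A ^ 3) ^ 4 * (cc a * MM f 0 s x) ^ α := by gcongr
      _ = (4 * D * A ^ 3) ^ 4 * (cc a / cc s * heatP f s x) ^ α := by
          rw [heatP_eq]
          congr 2
          field_simp
      _ = _ := by
          rw [Real.mul_rpow (by positivity) (hP s hs x).le]
          ring
  · intro r har hrb x
    have hr := ha.trans har
    have hp := hP r hr x
    refine ((heatP_dx f hf0 hf1 hf r hr x).rpow_const (p := α) (Or.inl hp.ne')).congr_deriv ?_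
    rw [Real.rpow_sub_one hp.ne']
    field_simp
  · exact fun r har hrb x => Q1_dx f hf0 hf1 hf r (ha.trans har) x
  · exact fun r har hrb x => Q2_dx f hf0 hf1 hf r (ha.trans har) x
  · exact fun r har hrb => Q3_cont f hf0 hf1 hf r (ha.trans har)
  · intro r har hrb x
    have hr := ha.trans har
    have hp := hP r hr x
    refine ((heatP_dt f hf0 hf1 hf r hr x).rpow_const (p := α) (Or.inl hp.ne')).congr_deriv ?_
    rw [Real.rpow_sub_one hp.ne']
    field_simp
  · exact fun r har hrb x => Q1_dt f hf0 hf1 hf r (ha.trans har) x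

/-- Second-order derivative of the Rényi entropy along the heat flow. -/
theorem renyi_second_derivative
    (f : ℝ → ℝ) (hfm : Measurable f) (hf0 : ∀ x, 0 ≤ f x)
    (hf1 : (∫ x : ℝ, f x) = 1)
    (α : ℝ) (hα : 0 < α) (hα1 : α ≠ 1)
    (t : ℝ) (ht : 0 < t) (htα : ltTalpha f α t) :
    DifferentiableAt ℝ (fun s => renyiEnt f α s) t
    ∧ HasDerivAt (deriv (fun s => renyiEnt f α s))
      (α / 12 *
        ((((α - 2) * (α - 3) * (∫ x : ℝ, heatP f t x ^ (α - 4) * (pk f 1 t x) ^ 4)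
            - 6 * (∫ x : ℝ, heatP f t x ^ (α - 2) * (pk f 2 t x) ^ 2))
              * (∫ x : ℝ, heatP f t x ^ α)
          + 3 * α * (α - 1) * (∫ x : ℝ, heatP f t x ^ (α - 2) * (pk f 1 t x) ^ 2) ^ 2)
          / (∫ x : ℝ, heatP f t x ^ α) ^ 2)) t
    ∧ α / 12 *
        ((((α - 2) * (α - 3) * (∫ x : ℝ, heatP f t x ^ (α - 4) * (pk f 1 t x) ^ 4)
            - 6 * (∫ x : ℝ, heatP f t x ^ (α - 2) * (pk f 2 t x) ^ 2))
              * (∫ x : ℝ, heatP f t x ^ α)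
          + 3 * α * (α - 1) * (∫ x : ℝ, heatP f t x ^ (α - 2) * (pk f 1 t x) ^ 2) ^ 2)
          / (∫ x : ℝ, heatP f t x ^ α) ^ 2)
      = α / 12 *
        ((α - 2) * (α - 3) * Ea f α t (fun x => (pbar f 1 t x) ^ 4)
          - 6 * Ea f α t (fun x => (pbar f 2 t x) ^ 2)
          + 3 * α * (α - 1) * (Ea f α t (fun x => (pbar f 1 t x) ^ 2)) ^ 2) := by
  have hf : Integrable f := by
    by_contra h
    rw [integral_undef h] at hf1
    norm_num at hf1
  obtain ⟨s, hts, hs, hfin⟩ := htα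
  unfold renyiFinite at hfin
  rw [if_neg hα1] at hfin
  have hI := hfin.1
  have hc := renyi_core f hf0 hf1 hf α hα s hI
  have hHpos : ∀ r, 0 < r → r < s → 0 < ∫ x, heatP f r x ^ α := by
    intro r hr hrs
    have hp := fun x => Real.rpow_pos_of_pos (heatP_pos f hf0 hf1 hf r hr x) α
    rw [integral_pos_iff_support_of_nonneg (fun x => (hp x).le) (hc r hr hrs).1]
    have : Function.support (fun x => heatP f r x ^ α) = Set.univ :=
      Set.eq_univ_of_forall fun x => (hp x).ne'
    rw [this]
    simp
  have hα1' : 1 - α ≠ 0 := sub_ne_zero.2 (Ne.symm hα1)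
  -- first derivative
  have hd : ∀ r, 0 < r → r < s → HasDerivAt (fun s => renyiEnt f α s)
      (α / 2 * ((∫ x, heatP f r x ^ α * Q1 f r x ^ 2) / ∫ x, heatP f r x ^ α)) r := by
    intro r hr hrs
    have e : (fun s => renyiEnt f α s) = fun s => (1 - α)⁻¹ * Real.log (∫ x, heatP f s x ^ α) := by
      funext s
      unfold renyiEnt
      rw [if_neg hα1]
    have hH := hHpos r hr hrs
    rw [e]
    refine (((hc r hr hrs).2.1.log hH.ne').const_mul _).congr_deriv ?_
    field_simp
    ring
  have hq1 : ∀ x, pk f 1 t x / heatP f t x = Q1 f t x := pbar1_eq f hf0 hf1 hf t ht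
  have hq2 : ∀ x, pk f 2 t x / heatP f t x = Q2 f t x := pbar2_eq f hf0 hf1 hf t ht
  have j4 : (∫ x : ℝ, heatP f t x ^ (α - 4) * (pk f 1 t x) ^ 4)
      = ∫ x, heatP f t x ^ α * Q1 f t x ^ 4 := by
    congr 1
    ext x
    rw [← hq1 x]
    exact rpow_pk _ _ α 4 (heatP_pos f hf0 hf1 hf t ht x)
  have j2 : (∫ x : ℝ, heatP f t x ^ (α - 2) * (pk f 1 t x) ^ 2)
      = ∫ x, heatP f t x ^ α * Q1 f t x ^ 2 := by
    congr 1
    ext x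
    rw [← hq1 x]
    exact rpow_pk _ _ α 2 (heatP_pos f hf0 hf1 hf t ht x)
  have j22 : (∫ x : ℝ, heatP f t x ^ (α - 2) * (pk f 2 t x) ^ 2)
      = ∫ x, heatP f t x ^ α * Q2 f t x ^ 2 := by
    congr 1
    ext x
    rw [← hq2 x]
    exact rpow_pk _ _ α 2 (heatP_pos f hf0 hf1 hf t ht x)
  have hH := hHpos t ht hts
  rw [j4, j2, j22]
  refine ⟨(hd t ht hts).differentiableAt, ?_, ?_⟩
  · have ev : deriv (fun s => renyiEnt f α s) =ᶠ[nhds t] fun r =>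
        α / 2 * ((∫ x, heatP f r x ^ α * Q1 f r x ^ 2) / ∫ x, heatP f r x ^ α) := by
      filter_upwards [Ioo_mem_nhds ht hts] with r hr using (hd r hr.1 hr.2).deriv
    have h2 := ((hc t ht hts).2.2.div (hc t ht hts).2.1 hH.ne').const_mul (α / 2)
    refine HasDerivAt.congr_of_eventuallyEq (h2.congr_deriv ?_) ev
    field_simp
    ring
  · unfold Ea
    simp only [pbar, hq1, hq2]
    simp only [mul_comm (_ ^ _) (heatP f t _ ^ α)]
    field_simp
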